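/- Let d ∈ ℕ with d ≥ 4 and let p ∈ [2, ∞). Then for every f ∈ l^p(ℤ^d) one has ‖ sup_{t ∈ 𝔻, t ≤ √d} |𝓜_t f| ‖_{l^p(ℤ^d)} ≤ 30^{4/p} · ‖f‖_{l^p(ℤ^d)}. -/

import Mathlib

open Finset MeasureTheory
open scoped ENNReal NNReal

noncomputable section

/-- The lattice points of the closed `l¹` ball of radius `t` in `ℤ^d`,
i.e. `B_t ∩ ℤ^d` where `B_t = {x ∈ ℝ^d : Σ |x_i| ≤ t}`. -/
def latticeBall (d t : ℕ) : Finset (Fin d → ℤ) :=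
  (Finset.Icc (fun _ => -(t : ℤ)) (fun _ => (t : ℤ))).filter fun y => ∑ i, |y i| ≤ (t : ℤ)

/-- The discrete Hardy–Littlewood averaging operator over the `l¹` ball:
`𝓜_t f (x) = |B_t ∩ ℤ^d|⁻¹ Σ_{y ∈ B_t ∩ ℤ^d} f (x - y)`. -/
def Mop (d t : ℕ) (f : (Fin d → ℤ) → ℂ) (x : Fin d → ℤ) : ℂ :=
  ((latticeBall d t).card : ℂ)⁻¹ * ∑ y ∈ latticeBall d t, f (x - y)

section Hilbert

variable {E : Type*} [NormedAddCommGroup E] [InnerProductSpace ℝ E]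

open scoped RealInnerProductSpace

theorem LinearMap.IsSymmetric.inner_pow_add {S : E →ₗ[ℝ] E} (hS : S.IsSymmetric) (a b : ℕ)
    (u v : E) : ⟪(S ^ (a + b)) u, v⟫ = ⟪(S ^ a) u, (S ^ b) v⟫ := by
  rw [add_comm, pow_add, Module.End.mul_apply]
  exact hS.pow b _ _

theorem LinearMap.norm_pow_apply_le {S : E →ₗ[ℝ] E} (hS : ∀ u, ‖S u‖ ≤ ‖u‖) (n : ℕ) (u : E) :
    ‖(S ^ n) u‖ ≤ ‖u‖ := by
  induction n with
  | zero => simp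
  | succ n ih =>
    rw [pow_succ', Module.End.mul_apply]
    exact (hS _).trans ih

/-- Along the orbit of a symmetric operator, squared norms are convex. -/
theorem LinearMap.IsSymmetric.antitone_normSq_diff {S : E →ₗ[ℝ] E} (hS : S.IsSymmetric) (u : E) :
    Antitone fun k : ℕ => ‖(S ^ k) u‖ ^ 2 - ‖(S ^ (k + 1)) u‖ ^ 2 := by
  refine antitone_nat_of_succ_le fun k => ?_
  have h1 : ‖(S ^ (k + 1)) u‖ ^ 2 = ⟪(S ^ k) u, (S ^ (k + 2)) u⟫ := by
    rw [← real_inner_self_eq_norm_sq, ← hS.inner_pow_add, ← hS.inner_pow_add]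
    congr 3
    ring
  have h2 := norm_sub_sq_real ((S ^ k) u) ((S ^ (k + 2)) u)
  have h3 := sq_nonneg ‖(S ^ k) u - (S ^ (k + 2)) u‖
  simp only [add_assoc, Nat.reduceAdd] at *
  linarith

theorem LinearMap.IsSymmetric.normSq_pow_sub_le {S : E →ₗ[ℝ] E} (hS : S.IsSymmetric)
    (a b : ℕ) (u : E) :
    ‖(S ^ a) u‖ ^ 2 - ‖(S ^ (a + b)) u‖ ^ 2 ≤ b / (a + 1) * ‖u‖ ^ 2 := by
  set D : ℕ → ℝ := fun k => ‖(S ^ k) u‖ ^ 2 - ‖(S ^ (k + 1)) u‖ ^ 2 with hD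
  have hanti : Antitone D := hS.antitone_normSq_diff u
  have h1 : (a + 1) * D a ≤ ‖u‖ ^ 2 := by
    have hsum : ∑ k ∈ Finset.range (a + 1), D k = ‖(S ^ 0) u‖ ^ 2 - ‖(S ^ (a + 1)) u‖ ^ 2 :=
      Finset.sum_range_sub' (fun k => ‖(S ^ k) u‖ ^ 2) (a + 1)
    have hle : ∑ _k ∈ Finset.range (a + 1), D a ≤ ∑ k ∈ Finset.range (a + 1), D k :=
      Finset.sum_le_sum fun k hk => hanti (Nat.lt_succ_iff.mp (Finset.mem_range.mp hk))
    rw [hsum] at hle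
    simp only [Finset.sum_const, Finset.card_range, nsmul_eq_mul, Nat.cast_add, Nat.cast_one, pow_zero,
      Module.End.one_apply] at hle
    linarith [sq_nonneg ‖(S ^ (a + 1)) u‖]
  have h2 : ‖(S ^ a) u‖ ^ 2 - ‖(S ^ (a + b)) u‖ ^ 2 ≤ b * D a := by
    have hsum : ∑ j ∈ Finset.range b, D (a + j) = ‖(S ^ (a + 0)) u‖ ^ 2 - ‖(S ^ (a + b)) u‖ ^ 2 :=
      Finset.sum_range_sub' (fun k => ‖(S ^ (a + k)) u‖ ^ 2) b
    have hle : ∑ j ∈ Finset.range b, D (a + j) ≤ ∑ _j ∈ Finset.range b, D a :=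
      Finset.sum_le_sum fun k _ => hanti (Nat.le_add_right a k)
    rw [hsum] at hle
    simpa using hle
  have h3 : D a ≤ ‖u‖ ^ 2 / (a + 1) := by
    rw [le_div_iff₀ (by positivity)]
    linarith
  calc _ ≤ b * D a := h2
    _ ≤ b * (‖u‖ ^ 2 / (a + 1)) := by gcongr
    _ = _ := by ring

theorem LinearMap.IsSymmetric.inner_pow_add_le {S : E →ₗ[ℝ] E} (hS : S.IsSymmetric)
    (hc : ∀ u, ‖S u‖ ≤ ‖u‖) (a b : ℕ) (u v : E) :
    ⟪(S ^ (2 * a + 2 * b)) u, v⟫ ≤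
      ⟪(S ^ (2 * a)) u, v⟫ + b / (a + 1) * ((‖u‖ ^ 2 + ‖v‖ ^ 2) / 2) := by
  have key : ∀ k (w : E), ⟪(S ^ (2 * k)) w, w⟫ = ‖(S ^ k) w‖ ^ 2 := fun k w => by
    rw [two_mul, hS.inner_pow_add, real_inner_self_eq_norm_sq]
  have hu := hS.normSq_pow_sub_le a b u
  have hv := hS.normSq_pow_sub_le a b v
  have hpos : ‖(S ^ (a + b)) (u + v)‖ ^ 2 ≤ ‖(S ^ a) (u + v)‖ ^ 2 := by
    rw [add_comm a b, pow_add, Module.End.mul_apply]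
    gcongr
    exact norm_pow_apply_le hc _ _
  have expand : ∀ k, ‖(S ^ k) (u + v)‖ ^ 2 =
      ‖(S ^ k) u‖ ^ 2 + 2 * ⟪(S ^ (2 * k)) u, v⟫ + ‖(S ^ k) v‖ ^ 2 := fun k => by
    rw [map_add, norm_add_sq_real, two_mul k, hS.inner_pow_add]
  rw [expand, expand] at hpos
  rw [← mul_add 2 a b]
  linarith

theorem sum_range_half_pow_dist_le (n N : ℕ) :
    ∑ m ∈ Finset.range N, (1 / 2 : ℝ) ^ (n - m + (m - n)) ≤ 3 := by
  have hgeom : ∀ k, ∑ j ∈ Finset.range k, (1 / 2 : ℝ) ^ j ≤ 2 := sum_geometric_two_le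
  calc ∑ m ∈ Finset.range N, (1 / 2 : ℝ) ^ (n - m + (m - n))
      ≤ ∑ m ∈ Finset.range (n + 1 + N), (1 / 2 : ℝ) ^ (n - m + (m - n)) := by
        refine Finset.sum_le_sum_of_subset_of_nonneg (Finset.range_mono (by omega)) ?_
        intros
        positivity
    _ = ∑ m ∈ Finset.range (n + 1), (1 / 2 : ℝ) ^ m + ∑ j ∈ Finset.range N, (1 / 2 : ℝ) ^ j * (1 / 2) := by
        rw [Finset.sum_range_add, ← Finset.sum_range_reflect]
        congr 1
        · refine Finset.sum_congr rfl fun m hm => ?_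
          have := Finset.mem_range.mp hm
          congr 1
          omega
        · refine Finset.sum_congr rfl fun m _ => ?_
          rw [← pow_succ]
          congr 1
          omega
    _ ≤ 3 := by
        rw [← Finset.sum_mul]
        linarith [hgeom (n + 1), hgeom N]

/-- Dual form of the dyadic maximal inequality for powers of a symmetric contraction. -/
theorem LinearMap.IsSymmetric.norm_sum_dyadic_pow_le {S : E →ₗ[ℝ] E} (hS : S.IsSymmetric)
    (hc : ∀ u, ‖S u‖ ≤ ‖u‖) (N : ℕ) (g : ℕ → E)
    (horth : ∀ n m, n ≠ m → ⟪g n, g m⟫ = 0)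
    (hpos : ∀ k n m, 0 ≤ ⟪(S ^ k) (g n), g m⟫) :
    ‖∑ n ∈ Finset.range N, (S ^ 2 ^ (n + 1)) (g n)‖ ≤ 3 * ‖∑ n ∈ Finset.range N, g n‖ := by
  set K := ∑ n ∈ Finset.range N, (S ^ 2 ^ (n + 1)) (g n) with hK
  set G := ∑ n ∈ Finset.range N, g n with hG
  have hGn : ‖G‖ ^ 2 = ∑ n ∈ Finset.range N, ‖g n‖ ^ 2 := by
    rw [← real_inner_self_eq_norm_sq, hG, sum_inner]
    refine Finset.sum_congr rfl fun n hn => ?_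
    rw [inner_sum, Finset.sum_eq_single_of_mem n hn fun m _ hm => horth n m hm.symm,
      real_inner_self_eq_norm_sq]
  have hlt : ∀ n m, m < n → ⟪(S ^ (2 ^ (n + 1) + 2 ^ (m + 1))) (g n), g m⟫ ≤
      ⟪(S ^ 2 ^ (n + 1)) (g n), g m⟫ +
        (1 / 2 : ℝ) ^ (n - m) * ((‖g n‖ ^ 2 + ‖g m‖ ^ 2) / 2) := fun n m hmn => by
    have h := hS.inner_pow_add_le hc (2 ^ n) (2 ^ m) (g n) (g m)
    have hr : ((2 ^ m : ℕ) : ℝ) / ((2 ^ n : ℕ) + 1) ≤ (1 / 2 : ℝ) ^ (n - m) := by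
      obtain ⟨k, rfl⟩ := Nat.exists_eq_add_of_lt hmn
      have : m + k + 1 - m = k + 1 := by omega
      rw [this, div_le_iff₀ (by positivity)]
      push_cast
      have h2 : (1 / 2 : ℝ) ^ (k + 1) * 2 ^ (m + k + 1) = 2 ^ m := by
        rw [add_assoc, pow_add 2 m, mul_left_comm, ← mul_pow]
        norm_num
      rw [mul_add, h2]
      linarith [show (0 : ℝ) ≤ (1 / 2 : ℝ) ^ (k + 1) * 1 by positivity]
    rw [← pow_succ', ← pow_succ'] at h
    refine h.trans ?_
    gcongr
  have hpair : ∀ n m, ⟪(S ^ 2 ^ (n + 1)) (g n), (S ^ 2 ^ (m + 1)) (g m)⟫ ≤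
      ⟪(S ^ 2 ^ (n + 1)) (g n), g m⟫ + ⟪(S ^ 2 ^ (m + 1)) (g m), g n⟫ +
        ((1 / 2 : ℝ) ^ (n - m + (m - n)) * ‖g n‖ ^ 2 / 2 +
          (1 / 2 : ℝ) ^ (m - n + (n - m)) * ‖g m‖ ^ 2 / 2) := fun n m => by
    have p1 := hpos (2 ^ (n + 1)) n m
    have p2 := hpos (2 ^ (m + 1)) m n
    rcases lt_trichotomy m n with h | rfl | h
    · rw [← hS.inner_pow_add]
      have := hlt n m h
      rw [Nat.sub_eq_zero_of_le h.le, zero_add, add_zero]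
      linarith
    · have : ‖(S ^ 2 ^ (m + 1)) (g m)‖ ^ 2 ≤ ‖g m‖ ^ 2 := by
        gcongr
        exact norm_pow_apply_le hc _ _
      rw [real_inner_self_eq_norm_sq]
      simp only [Nat.sub_self, add_zero, pow_zero, one_mul]
      linarith
    · rw [real_inner_comm, ← hS.inner_pow_add]
      have := hlt m n h
      rw [Nat.sub_eq_zero_of_le h.le, zero_add, add_zero]
      linarith
  have hsq : ‖K‖ ^ 2 ≤ 2 * ⟪K, G⟫ + 3 * ‖G‖ ^ 2 := by
    have e1 : ∑ n ∈ Finset.range N, ∑ m ∈ Finset.range N, ⟪(S ^ 2 ^ (n + 1)) (g n), g m⟫ = ⟪K, G⟫ := by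
      rw [hK, hG, sum_inner]
      simp only [inner_sum]
    have e2 : ∑ n ∈ Finset.range N, ∑ m ∈ Finset.range N,
        (1 / 2 : ℝ) ^ (n - m + (m - n)) * ‖g n‖ ^ 2 / 2 ≤ 3 / 2 * ‖G‖ ^ 2 := by
      rw [hGn, Finset.mul_sum]
      refine Finset.sum_le_sum fun n _ => ?_
      rw [← Finset.sum_div, ← Finset.sum_mul]
      have := mul_le_mul_of_nonneg_right (sum_range_half_pow_dist_le n N) (sq_nonneg ‖g n‖)
      linarith
    calc ‖K‖ ^ 2 = ∑ n ∈ Finset.range N, ∑ m ∈ Finset.range N,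
          ⟪(S ^ 2 ^ (n + 1)) (g n), (S ^ 2 ^ (m + 1)) (g m)⟫ := by
            rw [← real_inner_self_eq_norm_sq, hK, sum_inner]
            simp only [inner_sum]
      _ ≤ ∑ n ∈ Finset.range N, ∑ m ∈ Finset.range N, _ :=
            Finset.sum_le_sum fun n _ => Finset.sum_le_sum fun m _ => hpair n m
      _ ≤ _ := by
            simp only [Finset.sum_add_distrib]
            rw [e1, Finset.sum_comm (f := fun n m => ⟪(S ^ 2 ^ (m + 1)) (g m), g n⟫), e1,
              Finset.sum_comm
                (f := fun n m => (1 / 2 : ℝ) ^ (m - n + (n - m)) * ‖g m‖ ^ 2 / 2)]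
            linarith
  have hcs := real_inner_le_norm K G
  nlinarith [norm_nonneg K, norm_nonneg G]

end Hilbert

section Translation

variable {G : Type*}

theorem lp.real_inner_eq_tsum (f g : lp (fun _ : G => ℝ) 2) :
    inner ℝ f g = ∑' x, f x * g x := by
  rw [lp.inner_eq_tsum]
  exact tsum_congr fun x => by simp [mul_comm]

theorem lp.real_inner_nonneg {f g : lp (fun _ : G => ℝ) 2} (hf : ∀ x, 0 ≤ f x)
    (hg : ∀ x, 0 ≤ g x) : 0 ≤ inner ℝ f g := by
  rw [lp.real_inner_eq_tsum]
  exact tsum_nonneg fun x => mul_nonneg (hf x) (hg x)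

/-- Multiplication of a square-summable function by the indicator of a set. -/
def lpRestrict (A : Set G) (f : lp (fun _ : G => ℝ) 2) : lp (fun _ : G => ℝ) 2 :=
  ⟨A.indicator f, (lp.memℓp f).mono' fun x => by
    by_cases hx : x ∈ A <;> simp [hx]⟩

theorem lpRestrict_apply (A : Set G) (f : lp (fun _ : G => ℝ) 2) (x : G) :
    lpRestrict A f x = A.indicator f x := rfl

theorem LinearMap.pow_apply_nonneg {S : lp (fun _ : G => ℝ) 2 →ₗ[ℝ] lp (fun _ : G => ℝ) 2}
    (hpos : ∀ f : lp (fun _ : G => ℝ) 2, (∀ x, 0 ≤ f x) → ∀ x, 0 ≤ S f x)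
    {F : lp (fun _ : G => ℝ) 2} (hF : ∀ x, 0 ≤ F x) (k : ℕ) (x : G) : 0 ≤ (S ^ k) F x := by
  induction k generalizing x with
  | zero => simpa using hF x
  | succ k ih =>
    rw [pow_succ', Module.End.mul_apply]
    exact hpos _ ih x

/-- Maximal inequality along any selection of dyadic powers of a positivity preserving symmetric
contraction. -/
theorem exists_selection_dyadic_pow
    {S : lp (fun _ : G => ℝ) 2 →ₗ[ℝ] lp (fun _ : G => ℝ) 2} (hS : S.IsSymmetric)
    (hc : ∀ u, ‖S u‖ ≤ ‖u‖)
    (hpos : ∀ f : lp (fun _ : G => ℝ) 2, (∀ x, 0 ≤ f x) → ∀ x, 0 ≤ S f x)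
    {F : lp (fun _ : G => ℝ) 2} (hF : ∀ x, 0 ≤ F x) {N : ℕ} {ν : G → ℕ} (hν : ∀ x, ν x < N) :
    ∃ g : lp (fun _ : G => ℝ) 2, (∀ x, g x = (S ^ 2 ^ (ν x + 1)) F x) ∧ ‖g‖ ≤ 3 * ‖F‖ := by
  set u : ℕ → lp (fun _ : G => ℝ) 2 :=
    fun n => lpRestrict {x | ν x = n} ((S ^ 2 ^ (n + 1)) F) with hu
  have happ : ∀ n x, u n x = if ν x = n then (S ^ 2 ^ (n + 1)) F x else 0 := fun n x => by
    simp [hu, lpRestrict_apply, Set.indicator_apply]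
  have hnn : ∀ n x, 0 ≤ u n x := fun n x => by
    rw [happ]
    split_ifs
    exacts [LinearMap.pow_apply_nonneg hpos hF _ _, le_rfl]
  have horth : ∀ n m, n ≠ m → inner ℝ (u n) (u m) = 0 := fun n m hnm => by
    rw [lp.real_inner_eq_tsum]
    refine (tsum_congr fun x => ?_).trans tsum_zero
    rw [happ, happ]
    by_cases h : ν x = n
    · rw [if_neg (fun h' => hnm (h.symm.trans h')), mul_zero]
    · rw [if_neg h, zero_mul]
  have hself : ∀ n, inner ℝ (u n) (u n) = inner ℝ ((S ^ 2 ^ (n + 1)) (u n)) F := fun n => by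
    rw [hS.pow (2 ^ (n + 1)), lp.real_inner_eq_tsum, lp.real_inner_eq_tsum]
    refine tsum_congr fun x => ?_
    rw [happ]
    split_ifs <;> simp
  refine ⟨∑ n ∈ Finset.range N, u n, fun x => ?_, ?_⟩
  · rw [lp.coeFn_sum, Finset.sum_apply,
      Finset.sum_eq_single_of_mem (ν x) (Finset.mem_range.mpr (hν x)) fun n _ hn => ?_, happ,
      if_pos rfl]
    rw [happ, if_neg hn.symm]
  · have hdual := hS.norm_sum_dyadic_pow_le hc N u horth fun k n m =>
      lp.real_inner_nonneg (LinearMap.pow_apply_nonneg hpos (hnn n) k) (hnn m)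
    set g := ∑ n ∈ Finset.range N, u n with hg
    have hsq : ‖g‖ ^ 2 = inner ℝ (∑ n ∈ Finset.range N, (S ^ 2 ^ (n + 1)) (u n)) F := by
      rw [← real_inner_self_eq_norm_sq, hg, sum_inner, sum_inner]
      refine Finset.sum_congr rfl fun n hn => ?_
      rw [inner_sum, Finset.sum_eq_single_of_mem n hn fun m _ hm => horth n m hm.symm, hself]
    have hle : ‖g‖ * ‖g‖ ≤ 3 * ‖F‖ * ‖g‖ := by
      rw [← sq, hsq]
      calc _ ≤ _ := real_inner_le_norm _ _
        _ ≤ (3 * ‖g‖) * ‖F‖ := by gcongr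
        _ = _ := by ring
    rcases (norm_nonneg g).eq_or_lt with h0 | h0
    · rw [← h0]
      positivity
    · exact le_of_mul_le_mul_right hle h0

theorem exists_dyadic_maximal_bound
    {S : lp (fun _ : G => ℝ) 2 →ₗ[ℝ] lp (fun _ : G => ℝ) 2} (hS : S.IsSymmetric)
    (hc : ∀ u, ‖S u‖ ≤ ‖u‖)
    (hpos : ∀ f : lp (fun _ : G => ℝ) 2, (∀ x, 0 ≤ f x) → ∀ x, 0 ≤ S f x)
    {F : lp (fun _ : G => ℝ) 2} (hF : ∀ x, 0 ≤ F x) {N : ℕ} (hN : 0 < N) :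
    ∃ g : lp (fun _ : G => ℝ) 2, (∀ x, 0 ≤ g x) ∧
      (∀ n < N, ∀ x, (S ^ 2 ^ (n + 1)) F x ≤ g x) ∧ ‖g‖ ≤ 3 * ‖F‖ := by
  have hmax : ∀ x, ∃ n ∈ Finset.range N, ∀ m ∈ Finset.range N,
      (S ^ 2 ^ (m + 1)) F x ≤ (S ^ 2 ^ (n + 1)) F x := fun x =>
    Finset.exists_max_image (Finset.range N) (fun n => (S ^ 2 ^ (n + 1)) F x)
      ⟨0, Finset.mem_range.mpr hN⟩
  choose ν hν hνmax using hmax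
  obtain ⟨g, hg, hgF⟩ := exists_selection_dyadic_pow hS hc hpos hF
    fun x => Finset.mem_range.mp (hν x)
  refine ⟨g, fun x => ?_, fun n hn x => ?_, hgF⟩
  · rw [hg]
    exact LinearMap.pow_apply_nonneg hpos hF _ _
  · rw [hg]
    exact hνmax x n (Finset.mem_range.mpr hn)

variable [AddCommGroup G]

/-- Translation `f ↦ f (· - y)` on square-summable functions. -/
def lpTranslate (y : G) : lp (fun _ : G => ℝ) 2 →ₗ[ℝ] lp (fun _ : G => ℝ) 2 where
  toFun f := ⟨fun x => f (x - y), by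
    have h := (lp.memℓp f).summable (by norm_num)
    exact memℓp_gen (((Equiv.subRight y).summable_iff).mpr h)⟩
  map_add' _ _ := rfl
  map_smul' _ _ := rfl

theorem lpTranslate_apply (y : G) (f : lp (fun _ : G => ℝ) 2) (x : G) :
    lpTranslate y f x = f (x - y) := rfl

theorem norm_lpTranslate (y : G) (f : lp (fun _ : G => ℝ) 2) : ‖lpTranslate y f‖ = ‖f‖ := by
  rw [lp.norm_eq_tsum_rpow (by norm_num), lp.norm_eq_tsum_rpow (by norm_num)]
  congr 1
  exact (Equiv.subRight y).tsum_eq fun x => ‖f x‖ ^ ENNReal.toReal 2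

theorem inner_lpTranslate_left (y : G) (f g : lp (fun _ : G => ℝ) 2) :
    inner ℝ (lpTranslate y f) g = inner ℝ f (lpTranslate (-y) g) := by
  rw [lp.real_inner_eq_tsum, lp.real_inner_eq_tsum, ← (Equiv.subRight y).tsum_eq fun x => f x * lpTranslate (-y) g x]
  refine tsum_congr fun x => ?_
  simp [lpTranslate_apply]

/-- Convolution with the counting measure of a finite set. -/
def lpConv (A : Finset G) (f : lp (fun _ : G => ℝ) 2) : lp (fun _ : G => ℝ) 2 :=
  ∑ y ∈ A, lpTranslate y f

theorem lpConv_apply (A : Finset G) (f : lp (fun _ : G => ℝ) 2) (x : G) :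
    lpConv A f x = ∑ y ∈ A, f (x - y) := by
  rw [lpConv, lp.coeFn_sum, Finset.sum_apply]
  rfl

theorem norm_lpConv_le (A : Finset G) (f : lp (fun _ : G => ℝ) 2) :
    ‖lpConv A f‖ ≤ A.card * ‖f‖ := by
  refine (norm_sum_le _ _).trans_eq ?_
  simp [norm_lpTranslate]

end Translation

section SimpleWalk

variable {d : ℕ}

/-- The transition operator of the simple random walk on `ℤ^d`. -/
def walkOp (d : ℕ) :
    lp (fun _ : Fin d → ℤ => ℝ) 2 →ₗ[ℝ] lp (fun _ : Fin d → ℤ => ℝ) 2 :=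
  (2 * d : ℝ)⁻¹ • ∑ i, (lpTranslate (Pi.single i (1 : ℤ)) + lpTranslate (-Pi.single i (1 : ℤ)))

theorem walkOp_eq (f : lp (fun _ : Fin d → ℤ => ℝ) 2) :
    walkOp d f = (2 * d : ℝ)⁻¹ •
      ∑ i, (lpTranslate (Pi.single i (1 : ℤ)) f + lpTranslate (-Pi.single i (1 : ℤ)) f) := by
  simp [walkOp]

theorem walkOp_apply (f : lp (fun _ : Fin d → ℤ => ℝ) 2) (x : Fin d → ℤ) :
    walkOp d f x = (2 * d : ℝ)⁻¹ *
      ∑ i, (f (x - Pi.single i (1 : ℤ)) + f (x + Pi.single i (1 : ℤ))) := by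
  rw [walkOp_eq, lp.coeFn_smul, Pi.smul_apply, lp.coeFn_sum, Finset.sum_apply, smul_eq_mul]
  simp [lpTranslate_apply]

theorem walkOp_isSymmetric : (walkOp d).IsSymmetric := fun f g => by
  rw [walkOp_eq, walkOp_eq, inner_smul_left, inner_smul_right, sum_inner, inner_sum]
  simp only [inner_add_left, inner_add_right, inner_lpTranslate_left, neg_neg, conj_trivial]
  simp only [add_comm]

theorem norm_walkOp_le (f : lp (fun _ : Fin d → ℤ => ℝ) 2) : ‖walkOp d f‖ ≤ ‖f‖ := by
  rw [walkOp_eq, norm_smul, norm_inv, Real.norm_of_nonneg (by positivity : (0 : ℝ) ≤ 2 * d)]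
  have h : ‖∑ i : Fin d,
      (lpTranslate (Pi.single i (1 : ℤ)) f + lpTranslate (-Pi.single i (1 : ℤ)) f)‖
        ≤ 2 * d * ‖f‖ := by
    calc _ ≤ ∑ _i : Fin d, (‖f‖ + ‖f‖) := norm_sum_le_of_le _ fun i _ =>
          (norm_add_le _ _).trans_eq (by rw [norm_lpTranslate, norm_lpTranslate])
      _ = _ := by
          simp
          ring
  exact inv_mul_le_of_le_mul₀ (by positivity) (norm_nonneg _) h

theorem walkOp_nonneg (f : lp (fun _ : Fin d → ℤ => ℝ) 2) (hf : ∀ x, 0 ≤ f x) (x : Fin d → ℤ) :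
    0 ≤ walkOp d f x := by
  rw [walkOp_apply]
  exact mul_nonneg (by positivity) (Finset.sum_nonneg fun i _ => add_nonneg (hf _) (hf _))

end SimpleWalk

section Counting

variable {d : ℕ}

theorem mem_latticeBall {t : ℕ} {y : Fin d → ℤ} :
    y ∈ latticeBall d t ↔ ∑ i, |y i| ≤ (t : ℤ) := by
  rw [latticeBall, Finset.mem_filter, and_iff_right_iff_imp]
  intro h
  have hi : ∀ i, |y i| ≤ t := fun i =>
    (Finset.single_le_sum (f := fun i => |y i|) (fun i _ => abs_nonneg _)
      (Finset.mem_univ i)).trans h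
  exact Finset.mem_Icc.mpr ⟨fun i => (abs_le.mp (hi i)).1, fun i => (abs_le.mp (hi i)).2⟩

theorem card_latticeBall_pos (d t : ℕ) : 0 < (latticeBall d t).card :=
  Finset.card_pos.mpr ⟨0, mem_latticeBall.mpr (by simp)⟩

theorem sum_abs_update (x : Fin d → ℤ) (i : Fin d) (a : ℤ) :
    ∑ j, |Function.update x i a j| = ∑ j, |x j| - |x i| + |a| := by
  have h : ∀ j ∈ Finset.univ.erase i, |Function.update x i a j| = |x j| := fun j hj => by
    rw [Function.update_of_ne (Finset.ne_of_mem_erase hj)]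
  rw [← Finset.add_sum_erase _ _ (Finset.mem_univ i),
    ← Finset.add_sum_erase _ (fun j => |x j|) (Finset.mem_univ i), Finset.sum_congr rfl h,
    Function.update_self]
  ring

theorem card_filter_ne_zero_le (x : Fin d → ℤ) {k : ℕ} (hx : x ∈ latticeBall d k) :
    (Finset.univ.filter fun i => x i ≠ 0).card ≤ k := by
  have h : ((Finset.univ.filter fun i => x i ≠ 0).card : ℤ) ≤ ∑ i, |x i| := by
    rw [Finset.card_filter]
    push_cast
    refine Finset.sum_le_sum fun i _ => ?_
    split_ifs with hi
    · exact Int.one_le_abs hi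
    · exact abs_nonneg _
  exact_mod_cast h.trans (mem_latticeBall.mp hx)

theorem mul_card_latticeBall_le (d k : ℕ) :
    (d - k) * 2 * (latticeBall d k).card ≤ (k + 1) * (latticeBall d (k + 1)).card := by
  let P := (latticeBall d k).sigma fun x =>
    (Finset.univ.filter fun i => x i = 0) ×ˢ ({1, -1} : Finset ℤ)
  let R := (latticeBall d (k + 1)).sigma fun y => Finset.univ.filter fun i => y i ≠ 0
  have hP : (d - k) * 2 * (latticeBall d k).card ≤ P.card := by
    rw [Finset.card_sigma, mul_comm, ← smul_eq_mul]
    refine Finset.card_nsmul_le_sum _ _ _ fun x hx => ?_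
    rw [Finset.card_product, show ({1, -1} : Finset ℤ).card = 2 from rfl]
    have h1 := card_filter_ne_zero_le x hx
    have h2 := Finset.card_filter_add_card_filter_not (s := Finset.univ) fun i : Fin d => x i = 0
    rw [Finset.card_univ, Fintype.card_fin] at h2
    exact Nat.mul_le_mul_right 2 (by simp only [ne_eq] at h1; omega)
  have hR : R.card ≤ (k + 1) * (latticeBall d (k + 1)).card := by
    rw [Finset.card_sigma, mul_comm, ← smul_eq_mul]
    exact Finset.sum_le_card_nsmul _ _ _ fun y hy => card_filter_ne_zero_le y hy
  refine hP.trans (le_trans ?_ hR)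
  refine Finset.card_le_card_of_injOn
    (fun q => (⟨Function.update q.1 q.2.1 q.2.2, q.2.1⟩ : (_ : Fin d → ℤ) × Fin d)) ?_ ?_
  · rintro ⟨x, j, s⟩ h
    simp only [P, R, Finset.coe_sigma, Set.mem_sigma_iff, Finset.mem_coe, Finset.mem_product,
      Finset.mem_filter, Finset.mem_univ, true_and, mem_latticeBall, Finset.mem_insert,
      Finset.mem_singleton, Function.update_self, sum_abs_update] at h ⊢
    obtain ⟨h1, h2, rfl | rfl⟩ := h <;> rw [h2] <;> push_cast <;> simpa using h1
  · rintro ⟨x, j, s⟩ h ⟨x', j', s'⟩ h' heq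
    simp only [P, Finset.coe_sigma, Set.mem_sigma_iff, Finset.mem_coe, Finset.mem_product,
      Finset.mem_filter, Finset.mem_univ, true_and] at h h'
    simp only [Sigma.mk.injEq, heq_eq_eq] at heq
    obtain ⟨h1, rfl⟩ := heq
    have hs : s = s' := by simpa using congrFun h1 j
    have hx : x = x' := by
      have h2 := congrArg (fun y => Function.update y j 0) h1
      simp only [Function.update_idem] at h2
      rwa [← h.2.1, Function.update_eq_self, h.2.1, ← h'.2.1, Function.update_eq_self] at h2
    rw [hs, hx]

/-- The lattice points of `l¹` norm `k` all of whose coordinates lie in `{-1, 0, 1}`. -/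
def signSphere (d k : ℕ) : Finset (Fin d → ℤ) :=
  (latticeBall d k).filter fun y => ∑ i, |y i| = (k : ℤ) ∧ ∀ i, |y i| ≤ 1

theorem mem_signSphere {k : ℕ} {y : Fin d → ℤ} :
    y ∈ signSphere d k ↔ ∑ i, |y i| = (k : ℤ) ∧ ∀ i, |y i| ≤ 1 := by
  rw [signSphere, Finset.mem_filter, mem_latticeBall, and_iff_right_iff_imp]
  exact fun h => h.1.le

theorem signSphere_subset (d k : ℕ) : signSphere d k ⊆ latticeBall d k :=
  Finset.filter_subset _ _

theorem card_latticeBall_sdiff_signSphere_le (d k : ℕ) :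
    (latticeBall d (k + 1) \ signSphere d (k + 1)).card ≤ (k + 1) * (latticeBall d k).card := by
  have hsub : latticeBall d (k + 1) \ signSphere d (k + 1) ⊆ latticeBall d k ∪
      (latticeBall d k).biUnion fun x => (Finset.univ.filter fun i => x i ≠ 0).image
        fun i => Function.update x i (x i + SignType.sign (x i)) := by
    intro x hx
    rw [Finset.mem_sdiff, mem_latticeBall, mem_signSphere] at hx
    obtain ⟨hx1, hx2⟩ := hx
    rw [Finset.mem_union]
    by_cases hk : ∑ i, |x i| ≤ (k : ℤ)
    · exact Or.inl (mem_latticeBall.mpr hk)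
    · right
      push_cast at hx1 hx2
      have heq : ∑ i, |x i| = (k : ℤ) + 1 := by omega
      obtain ⟨i, hi⟩ : ∃ i, 1 < |x i| := by
        by_contra! h
        exact hx2 ⟨heq, h⟩
      obtain ⟨s, hs1, hs2⟩ : ∃ s : ℤ, |x i - s| = |x i| - 1 ∧ x i - s ≠ 0 ∧
          (SignType.sign (x i - s) : ℤ) = s := by
        rcases lt_abs.mp hi with h | h
        · refine ⟨1, ?_, by omega, ?_⟩
          · rw [abs_of_pos (by omega : 0 < x i), abs_of_pos (by omega)]
          · rw [sign_pos (by omega : 0 < x i - 1)]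
            rfl
        · refine ⟨-1, ?_, by omega, ?_⟩
          · rw [abs_of_neg (by omega : x i < 0), abs_of_neg (by omega)]
            ring
          · rw [sign_neg (by omega : x i - -1 < 0)]
            rfl
      refine Finset.mem_biUnion.mpr ⟨Function.update x i (x i - s), ?_, ?_⟩
      · rw [mem_latticeBall, sum_abs_update]
        omega
      · refine Finset.mem_image.mpr ⟨i, by simpa using hs2.1, ?_⟩
        simp [hs2.2]
  refine (Finset.card_le_card hsub).trans ((Finset.card_union_le _ _).trans ?_)
  have h := Finset.card_biUnion_le_card_mul (latticeBall d k)
    (fun x => (Finset.univ.filter fun i => x i ≠ 0).image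
        fun i => Function.update x i (x i + SignType.sign (x i))) k
    fun x hx => Finset.card_image_le.trans (card_filter_ne_zero_le x hx)
  linarith

theorem sum_filter_signSphere_le {k : ℕ} {h : (Fin d → ℤ) → ℝ} (hh : ∀ x, 0 ≤ h x) (i : Fin d)
    {s : ℤ} (hs : |s| = 1) :
    ∑ y ∈ (signSphere d (k + 1)).filter (fun y => y i = s), h y ≤
      ∑ z ∈ signSphere d k, h (z + Pi.single i s) := by
  have hinj : Function.Injective fun z : Fin d → ℤ => z + Pi.single i s :=
    add_left_injective _
  rw [← Finset.sum_image (f := h) (s := signSphere d k) hinj.injOn]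
  refine Finset.sum_le_sum_of_subset_of_nonneg (fun y hy => ?_) fun y _ _ => hh y
  rw [Finset.mem_filter, mem_signSphere] at hy
  obtain ⟨⟨h1, h2⟩, h3⟩ := hy
  refine Finset.mem_image.mpr ⟨Function.update y i 0, ?_, ?_⟩
  · rw [mem_signSphere, sum_abs_update, h1, h3, hs]
    refine ⟨by push_cast; simp, fun j => ?_⟩
    by_cases hj : j = i
    · subst hj
      simp
    · rw [Function.update_of_ne hj]
      exact h2 j
  · ext j
    by_cases hj : j = i
    · subst hj
      simp [h3]
    · simp [hj]

theorem succ_mul_sum_signSphere_le {k : ℕ} {h : (Fin d → ℤ) → ℝ} (hh : ∀ x, 0 ≤ h x) :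
    ((k : ℝ) + 1) * ∑ y ∈ signSphere d (k + 1), h y ≤
      ∑ i, (∑ z ∈ signSphere d k, h (z + Pi.single i 1) +
        ∑ z ∈ signSphere d k, h (z + Pi.single i (-1))) := by
  have hpt : ∀ y ∈ signSphere d (k + 1), ((k : ℝ) + 1) * h y =
      ∑ i, ((if y i = 1 then h y else 0) + if y i = -1 then h y else 0) := fun y hy => by
    obtain ⟨h1, h2⟩ := mem_signSphere.mp hy
    have h3 : ((k : ℝ) + 1) = ∑ i, ((|y i| : ℤ) : ℝ) := by
      rw [← Int.cast_sum, h1]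
      push_cast
      ring
    rw [h3, Finset.sum_mul]
    refine Finset.sum_congr rfl fun i _ => ?_
    have h4 := abs_le.mp (h2 i)
    obtain h5 | h5 | h5 : y i = -1 ∨ y i = 0 ∨ y i = 1 := by omega
    all_goals simp [h5]
  rw [Finset.mul_sum, Finset.sum_congr rfl hpt, Finset.sum_comm]
  refine Finset.sum_le_sum fun i _ => ?_
  rw [Finset.sum_add_distrib, ← Finset.sum_filter, ← Finset.sum_filter]
  exact add_le_add (sum_filter_signSphere_le hh i (by simp))
    (sum_filter_signSphere_le hh i (by simp))

/-- Convolution with `signSphere d k` is dominated by the `k`-step simple random walk. -/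
theorem factorial_mul_sum_signSphere_le {F : lp (fun _ : Fin d → ℤ => ℝ) 2} (hF : ∀ x, 0 ≤ F x)
    (k : ℕ) (x : Fin d → ℤ) :
    (k.factorial : ℝ) * ∑ y ∈ signSphere d k, F (x - y) ≤
      (2 * d : ℝ) ^ k * (walkOp d ^ k) F x := by
  induction k generalizing x with
  | zero =>
    have : signSphere d 0 ⊆ {0} := fun y hy => by
      have h := (mem_signSphere.mp hy).1
      rw [Nat.cast_zero, Finset.sum_eq_zero_iff_of_nonneg fun i _ => abs_nonneg _] at h
      simp only [Finset.mem_singleton]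
      ext i
      simpa using h i (Finset.mem_univ i)
    simpa using Finset.sum_le_sum_of_subset_of_nonneg this
      fun y _ _ => hF (x - y)
  | succ k ih =>
    have h := succ_mul_sum_signSphere_le (d := d) (k := k) (h := fun y => F (x - y))
      fun y => hF _
    have hstep : (2 * d : ℝ) * (walkOp d ^ (k + 1)) F x =
        ∑ i, ((walkOp d ^ k) F (x - Pi.single i (1 : ℤ)) +
          (walkOp d ^ k) F (x + Pi.single i (1 : ℤ))) := by
      rw [pow_succ', Module.End.mul_apply, walkOp_apply]
      rcases d.eq_zero_or_pos with rfl | hd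
      · simp
      · rw [mul_inv_cancel_left₀ (by positivity)]
    calc ((k + 1).factorial : ℝ) * ∑ y ∈ signSphere d (k + 1), F (x - y)
        = k.factorial * (((k : ℝ) + 1) * ∑ y ∈ signSphere d (k + 1), F (x - y)) := by
          rw [Nat.factorial_succ]
          push_cast
          ring
      _ ≤ k.factorial * ∑ i, (∑ z ∈ signSphere d k, F (x - (z + Pi.single i 1)) +
            ∑ z ∈ signSphere d k, F (x - (z + Pi.single i (-1)))) := by gcongr
      _ = ∑ i, (k.factorial * ∑ z ∈ signSphere d k, F (x - Pi.single i 1 - z) +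
            k.factorial * ∑ z ∈ signSphere d k, F (x + Pi.single i 1 - z)) := by
          rw [Finset.mul_sum]
          refine Finset.sum_congr rfl fun i _ => ?_
          rw [mul_add]
          simp only [sub_add_eq_sub_sub_swap, Pi.single_neg, sub_neg_eq_add]
      _ ≤ ∑ i, ((2 * d : ℝ) ^ k * (walkOp d ^ k) F (x - Pi.single i (1 : ℤ)) +
            (2 * d : ℝ) ^ k * (walkOp d ^ k) F (x + Pi.single i (1 : ℤ))) :=
          Finset.sum_le_sum fun i _ => add_le_add (ih _) (ih _)
      _ = (2 * d : ℝ) ^ (k + 1) * (walkOp d ^ (k + 1)) F x := by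
          rw [pow_succ, mul_assoc, hstep, Finset.mul_sum]
          simp only [mul_add]

theorem le_factorial_mul_card_latticeBall (d k : ℕ) (hk : k ≤ d) :
    (2 * d : ℝ) ^ k * (2 * d - (k : ℝ) ^ 2) ≤
      2 * d * (k.factorial * (latticeBall d k).card) := by
  induction k with
  | zero =>
    have : (1 : ℝ) ≤ (latticeBall d 0).card := by exact_mod_cast card_latticeBall_pos d 0
    simp only [pow_zero, CharP.cast_eq_zero, ne_eq, OfNat.ofNat_ne_zero, not_false_eq_true,
      zero_pow, sub_zero, one_mul, Nat.factorial_zero, Nat.cast_one]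
    exact le_mul_of_one_le_right (by positivity) this
  | succ k ih =>
    have h1 := ih (by omega)
    have h2 : ((d : ℝ) - k) * 2 * (latticeBall d k).card ≤
        (k + 1) * (latticeBall d (k + 1)).card := by
      rw [← Nat.cast_sub (by omega)]
      exact_mod_cast mul_card_latticeBall_le d k
    have hdk : (0 : ℝ) ≤ d - k := by
      rw [sub_nonneg]
      exact_mod_cast (by omega : k ≤ d)
    calc (2 * d : ℝ) ^ (k + 1) * (2 * d - ((k + 1 : ℕ) : ℝ) ^ 2)
        ≤ (2 * d : ℝ) ^ k * (2 * (d - k) * (2 * d - (k : ℝ) ^ 2)) := by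
          rw [pow_succ, mul_assoc]
          refine mul_le_mul_of_nonneg_left ?_ (by positivity)
          push_cast
          nlinarith [show (0 : ℝ) ≤ k ^ 3 by positivity, show (0 : ℝ) ≤ d by positivity]
      _ = 2 * (d - k) * ((2 * d : ℝ) ^ k * (2 * d - (k : ℝ) ^ 2)) := by ring
      _ ≤ 2 * (d - k) * (2 * d * (k.factorial * (latticeBall d k).card)) := by gcongr
      _ = 2 * d * (k.factorial * ((d - k) * 2 * (latticeBall d k).card)) := by ring
      _ ≤ 2 * d * (k.factorial * ((k + 1) * (latticeBall d (k + 1)).card)) := by gcongr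
      _ = 2 * d * ((k + 1).factorial * (latticeBall d (k + 1)).card) := by
          rw [Nat.factorial_succ]
          push_cast
          ring

/-- On the range `t ≤ √d` the normalised convolution with `signSphere d t` is dominated by
the `t`-step simple random walk. -/
theorem sum_signSphere_div_card_le {F : lp (fun _ : Fin d → ℤ => ℝ) 2} (hF : ∀ x, 0 ≤ F x)
    {t : ℕ} (ht : t ^ 2 ≤ d) (hd : 0 < d) (x : Fin d → ℤ) :
    ((latticeBall d t).card : ℝ)⁻¹ * ∑ y ∈ signSphere d t, F (x - y) ≤
      2 * (walkOp d ^ t) F x := by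
  have htd : (t : ℝ) ^ 2 ≤ d := by exact_mod_cast ht
  have hd' : (0 : ℝ) < d := by exact_mod_cast hd
  have hB : (0 : ℝ) < (latticeBall d t).card := by exact_mod_cast card_latticeBall_pos d t
  have hW := LinearMap.pow_apply_nonneg walkOp_nonneg hF t x
  have h1 := le_factorial_mul_card_latticeBall d t ((Nat.le_self_pow two_ne_zero t).trans ht)
  have h2 : (2 * d : ℝ) ^ t ≤ 2 * (t.factorial * (latticeBall d t).card) := by
    have : (2 * d : ℝ) ^ t * d ≤ (2 * d : ℝ) ^ t * (2 * d - (t : ℝ) ^ 2) := by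
      gcongr
      linarith
    refine le_of_mul_le_mul_right ?_ hd'
    linarith
  have h3 := factorial_mul_sum_signSphere_le hF t x
  have hf : (0 : ℝ) < t.factorial := by exact_mod_cast t.factorial_pos
  rw [inv_mul_le_iff₀ hB]
  refine le_of_mul_le_mul_left ?_ hf
  calc _ ≤ _ := h3
    _ ≤ (2 * (t.factorial * (latticeBall d t).card)) * (walkOp d ^ t) F x := by gcongr
    _ = _ := by ring

theorem card_sdiff_signSphere_div_le {t : ℕ} (ht2 : 2 ≤ t) (ht : t ^ 2 ≤ d) :
    ((latticeBall d t).card : ℝ)⁻¹ * (latticeBall d t \ signSphere d t).card ≤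
      (t : ℝ) ^ 2 / d := by
  obtain ⟨k, rfl⟩ : ∃ k, t = k + 1 := ⟨t - 1, by omega⟩
  have hB : (0 : ℝ) < (latticeBall d (k + 1)).card := by
    exact_mod_cast card_latticeBall_pos d (k + 1)
  have hdk : d ≤ (d - k) * 2 := by
    have : 2 * k ≤ (k + 1) ^ 2 := by nlinarith
    omega
  have hd : 0 < d := by nlinarith
  have h1 := card_latticeBall_sdiff_signSphere_le d k
  have h2 : d * (latticeBall d k).card ≤ (k + 1) * (latticeBall d (k + 1)).card :=
    (Nat.mul_le_mul_right _ hdk).trans (mul_card_latticeBall_le d k)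
  have h3 : d * (latticeBall d (k + 1) \ signSphere d (k + 1)).card ≤
      (k + 1) ^ 2 * (latticeBall d (k + 1)).card := by nlinarith
  rw [inv_mul_le_iff₀ hB, mul_div_assoc', le_div_iff₀ (by exact_mod_cast hd)]
  rw [mul_comm, mul_comm (Nat.cast _ : ℝ) (_ ^ 2)]
  exact_mod_cast h3

end Counting

section Maximal

variable {d : ℕ}

theorem sum_range_four_pow_succ_le (N : ℕ) :
    ∑ n ∈ Finset.range N, ((2 ^ (n + 1) : ℕ) : ℝ) ^ 2 ≤ 4 / 3 * 4 ^ N := by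
  induction N with
  | zero => norm_num
  | succ N ih =>
    rw [Finset.sum_range_succ, pow_succ (4 : ℝ)]
    have : ((2 ^ (N + 1) : ℕ) : ℝ) ^ 2 = 4 * 4 ^ N := by
      push_cast
      rw [← pow_mul, mul_comm, pow_mul, pow_succ]
      norm_num [mul_comm]
    rw [this]
    linarith

theorem exists_ball_average_le {F : lp (fun _ : Fin d → ℤ => ℝ) 2} (hd : 4 ≤ d)
    (hF : ∀ x, 0 ≤ F x) :
    ∃ g : lp (fun _ : Fin d → ℤ => ℝ) 2, (∀ x, 0 ≤ g x) ∧
      (∀ n, (2 ^ n) ^ 2 ≤ d → ∀ x,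
        ((latticeBall d (2 ^ n)).card : ℝ)⁻¹ * ∑ y ∈ latticeBall d (2 ^ n), F (x - y) ≤ g x) ∧
      ‖g‖ ≤ 900 * ‖F‖ := by
  set N := Nat.log 4 d with hN
  have hN0 : 0 < N := Nat.log_pos (by norm_num) hd
  have hd0 : 0 < d := by omega
  have hNd : 4 ^ N ≤ d := Nat.pow_log_le_self 4 hd0.ne'
  have hsq : ∀ n, (2 ^ n) ^ 2 = 4 ^ n := fun n => by
    rw [← pow_mul, mul_comm, pow_mul]
    norm_num
  obtain ⟨g, hg0, hg, hgF⟩ :=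
    exists_dyadic_maximal_bound walkOp_isSymmetric norm_walkOp_le walkOp_nonneg hF hN0
  set A : (t : ℕ) → Finset (Fin d → ℤ) → lp (fun _ : Fin d → ℤ => ℝ) 2 :=
    fun t s => ((latticeBall d t).card : ℝ)⁻¹ • lpConv s F with hA
  have hAapp : ∀ t s x, A t s x = ((latticeBall d t).card : ℝ)⁻¹ * ∑ y ∈ s, F (x - y) :=
    fun t s x => by rw [hA, lp.coeFn_smul, Pi.smul_apply, smul_eq_mul, lpConv_apply]
  have hA0 : ∀ t s x, 0 ≤ A t s x := fun t s x => by
    rw [hAapp]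
    exact mul_nonneg (by positivity) (Finset.sum_nonneg fun y _ => hF _)
  have hAnorm : ∀ t s, ‖A t s‖ ≤ ((latticeBall d t).card : ℝ)⁻¹ * s.card * ‖F‖ := fun t s => by
    rw [hA, norm_smul, norm_inv, Real.norm_natCast, mul_assoc]
    gcongr
    exact norm_lpConv_le s F
  set R := ∑ n ∈ Finset.range N,
    A (2 ^ (n + 1)) (latticeBall d (2 ^ (n + 1)) \ signSphere d (2 ^ (n + 1))) with hR
  have hRapp : ∀ x, R x = ∑ n ∈ Finset.range N,
      A (2 ^ (n + 1)) (latticeBall d (2 ^ (n + 1)) \ signSphere d (2 ^ (n + 1))) x := fun x => by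
    rw [hR, lp.coeFn_sum, Finset.sum_apply]
  have hR0 : ∀ x, 0 ≤ R x := fun x => by
    rw [hRapp]
    exact Finset.sum_nonneg fun n _ => hA0 _ _ x
  have hpow : ∀ n < N, (2 ^ (n + 1)) ^ 2 ≤ d := fun n hn => by
    rw [hsq]
    exact (Nat.pow_le_pow_right (by norm_num) hn).trans hNd
  have hRnorm : ‖R‖ ≤ 4 / 3 * ‖F‖ := by
    have hd' : (0 : ℝ) < d := by exact_mod_cast hd0
    calc ‖R‖ ≤ ∑ n ∈ Finset.range N, ((2 ^ (n + 1) : ℕ) : ℝ) ^ 2 / d * ‖F‖ := by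
          refine norm_sum_le_of_le _ fun n hn => (hAnorm _ _).trans ?_
          gcongr
          refine card_sdiff_signSphere_div_le ?_ (hpow n (Finset.mem_range.mp hn))
          exact Nat.le_self_pow (by omega) 2
      _ = (∑ n ∈ Finset.range N, ((2 ^ (n + 1) : ℕ) : ℝ) ^ 2) / d * ‖F‖ := by
          rw [← Finset.sum_mul, Finset.sum_div]
      _ ≤ 4 / 3 * ‖F‖ := by
          refine mul_le_mul_of_nonneg_right ?_ (norm_nonneg F)
          rw [div_le_iff₀ hd']
          refine (sum_range_four_pow_succ_le N).trans ?_
          gcongr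
          exact_mod_cast hNd
  have happ : ∀ x, (A 1 (latticeBall d 1) + (2 : ℝ) • g + R) x =
      A 1 (latticeBall d 1) x + 2 * g x + R x := fun x => rfl
  refine ⟨A 1 (latticeBall d 1) + (2 : ℝ) • g + R, fun x => ?_, fun n hn x => ?_, ?_⟩
  · rw [happ]
    linarith [hA0 1 (latticeBall d 1) x, hg0 x, hR0 x]
  · rw [happ]
    cases n with
    | zero =>
      rw [pow_zero, ← hAapp]
      linarith [hg0 x, hR0 x]
    | succ n =>
      have hnN : n < N := by
        rw [hsq] at hn
        exact Nat.le_log_of_pow_le (by norm_num) hn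
      have h1 := sum_signSphere_div_card_le hF hn hd0 x
      have h2 := hg n hnN x
      have h3 : A (2 ^ (n + 1)) (latticeBall d (2 ^ (n + 1)) \ signSphere d (2 ^ (n + 1))) x
          ≤ R x := by
        rw [hRapp]
        exact Finset.single_le_sum (f := fun n => A (2 ^ (n + 1))
          (latticeBall d (2 ^ (n + 1)) \ signSphere d (2 ^ (n + 1))) x)
          (fun n _ => hA0 _ _ x) (Finset.mem_range.mpr hnN)
      rw [hAapp] at h3
      rw [← Finset.sum_sdiff (signSphere_subset d (2 ^ (n + 1))), mul_add]
      linarith [hA0 1 (latticeBall d 1) x]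
  · have h1 : ‖A 1 (latticeBall d 1)‖ ≤ ‖F‖ := by
      have hB : ((latticeBall d 1).card : ℝ) ≠ 0 := by
        exact_mod_cast (card_latticeBall_pos d 1).ne'
      simpa [inv_mul_cancel₀ hB] using hAnorm 1 (latticeBall d 1)
    have h2 : ‖(2 : ℝ) • g‖ = 2 * ‖g‖ := by rw [norm_smul, Real.norm_ofNat]
    have h3 := norm_add₃_le (a := A 1 (latticeBall d 1)) (b := (2 : ℝ) • g) (c := R)
    linarith [norm_nonneg F]

/-- Jensen's inequality for the averaging operator. -/
theorem norm_Mop_rpow_le (d t : ℕ) {q : ℝ} (hq : 1 ≤ q) (f : (Fin d → ℤ) → ℂ)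
    (x : Fin d → ℤ) :
    ‖Mop d t f x‖ ^ q ≤
      ((latticeBall d t).card : ℝ)⁻¹ * ∑ y ∈ latticeBall d t, ‖f (x - y)‖ ^ q := by
  have hB : ((latticeBall d t).card : ℝ) ≠ 0 := by
    exact_mod_cast (card_latticeBall_pos d t).ne'
  have h1 : ‖Mop d t f x‖ ≤
      ∑ y ∈ latticeBall d t, ((latticeBall d t).card : ℝ)⁻¹ * ‖f (x - y)‖ := by
    rw [Mop, norm_mul, norm_inv, RCLike.norm_natCast, ← Finset.mul_sum]
    gcongr
    exact norm_sum_le _ _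
  calc _ ≤ (∑ y ∈ latticeBall d t, ((latticeBall d t).card : ℝ)⁻¹ * ‖f (x - y)‖) ^ q := by
        gcongr
    _ ≤ ∑ y ∈ latticeBall d t, ((latticeBall d t).card : ℝ)⁻¹ * ‖f (x - y)‖ ^ q :=
        Real.rpow_arith_mean_le_arith_mean_rpow _ _ _ (fun _ _ => by positivity)
          (by simp [mul_inv_cancel₀ hB]) (fun _ _ => norm_nonneg _) hq
    _ = _ := by rw [Finset.mul_sum]

theorem lp.tsum_ofReal_sq {G : Type*} (g : lp (fun _ : G => ℝ) 2) :
    ∑' x, ENNReal.ofReal (g x ^ 2) = ENNReal.ofReal (‖g‖ ^ 2) := by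
  have h := lp.hasSum_inner (𝕜 := ℝ) g g
  rw [real_inner_self_eq_norm_sq] at h
  simp only [real_inner_self_eq_norm_sq, Real.norm_eq_abs, sq_abs] at h
  rw [← h.tsum_eq, ENNReal.ofReal_tsum_of_nonneg (fun x => sq_nonneg _) h.summable]

end Maximal

/-- Theorem 1.1: for `d ≥ 4`, `p ∈ [2, ∞)` and `f ∈ l^p(ℤ^d)`,
`‖ sup_{t ∈ 𝔻, t ≤ √d} |𝓜_t f| ‖_{l^p(ℤ^d)} ≤ 30^(4/p) ‖f‖_{l^p(ℤ^d)}`. -/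
theorem dyadic_maximal_l1ball_lp_bound (d : ℕ) (hd : 4 ≤ d) (p : ℝ) (hp : 2 ≤ p)
    (f : (Fin d → ℤ) → ℂ) (hf : Memℓp f (ENNReal.ofReal p)) :
    (∑' x : Fin d → ℤ,
        (⨆ (n : ℕ) (_ : ((2 ^ n : ℕ) : ℝ) ≤ Real.sqrt d),
          (‖Mop d (2 ^ n) f x‖₊ : ℝ≥0∞)) ^ p) ^ (1 / p)
      ≤ ENNReal.ofReal ((30 : ℝ) ^ (4 / p)) *
        (∑' x : Fin d → ℤ, (‖f x‖₊ : ℝ≥0∞) ^ p) ^ (1 / p) := by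
  have hp0 : 0 < p := by linarith
  have hrpow : ∀ {a : ℝ}, 0 ≤ a → (a ^ (p / 2)) ^ 2 = a ^ p := fun {a} ha => by
    rw [← Real.rpow_natCast, ← Real.rpow_mul ha]
    congr 1
    push_cast
    ring
  have hmem : Memℓp (fun x => ‖f x‖ ^ (p / 2)) 2 := by
    have h := hf.summable (by rwa [ENNReal.toReal_ofReal hp0.le])
    rw [ENNReal.toReal_ofReal hp0.le] at h
    refine memℓp_gen (h.congr fun x => ?_)
    rw [Real.norm_of_nonneg (by positivity), ENNReal.toReal_ofNat, Real.rpow_ofNat,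
      hrpow (norm_nonneg _)]
  set F : lp (fun _ : Fin d → ℤ => ℝ) 2 := ⟨fun x => ‖f x‖ ^ (p / 2), hmem⟩ with hFdef
  have hFapp : ∀ x, F x = ‖f x‖ ^ (p / 2) := fun x => rfl
  obtain ⟨g, hg0, hg, hgF⟩ := exists_ball_average_le (F := F) hd fun x => by
    rw [hFapp]
    positivity
  have hright : ∑' x, (‖f x‖₊ : ℝ≥0∞) ^ p = ENNReal.ofReal (‖F‖ ^ 2) := by
    rw [← lp.tsum_ofReal_sq]
    refine tsum_congr fun x => ?_
    rw [hFapp, hrpow (norm_nonneg _), ← ENNReal.ofReal_rpow_of_nonneg (norm_nonneg _) hp0.le,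
      ofReal_norm, enorm_eq_nnnorm]
  have hleft : ∑' x : Fin d → ℤ, (⨆ (n : ℕ) (_ : ((2 ^ n : ℕ) : ℝ) ≤ Real.sqrt d),
      (‖Mop d (2 ^ n) f x‖₊ : ℝ≥0∞)) ^ p ≤ ENNReal.ofReal (‖g‖ ^ 2) := by
    rw [← lp.tsum_ofReal_sq]
    refine ENNReal.tsum_le_tsum fun x => ?_
    rw [← ENNReal.le_rpow_inv_iff hp0]
    refine iSup₂_le fun n hn => ?_
    have hnd : (2 ^ n) ^ 2 ≤ d := by
      have := Real.le_sqrt' (by positivity) |>.mp hn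
      exact_mod_cast this
    rw [ ENNReal.le_rpow_inv_iff hp0, ← enorm_eq_nnnorm, ← ofReal_norm,
      ENNReal.ofReal_rpow_of_nonneg (norm_nonneg _) hp0.le]
    refine ENNReal.ofReal_le_ofReal ?_
    rw [← hrpow (norm_nonneg _)]
    gcongr
    exact (norm_Mop_rpow_le d (2 ^ n) (by linarith) f x).trans (hg n hnd x)
  have hconst : ((900 : ℝ) ^ 2) ^ (1 / p) = 30 ^ (4 / p) := by
    rw [show (900 : ℝ) ^ 2 = 30 ^ (4 : ℝ) by norm_num, ← Real.rpow_mul (by norm_num),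
      mul_one_div]
  calc _ ≤ ENNReal.ofReal ((900 : ℝ) ^ 2 * ‖F‖ ^ 2) ^ (1 / p) := by
        refine ENNReal.rpow_le_rpow (hleft.trans (ENNReal.ofReal_le_ofReal ?_)) (by positivity)
        rw [← mul_pow]
        gcongr
    _ = _ := by
        rw [hright, ENNReal.ofReal_mul (by positivity),
          ENNReal.mul_rpow_of_nonneg _ _ (by positivity),
          ENNReal.ofReal_rpow_of_nonneg (by positivity) (by positivity), hconst]
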